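/- arXiv:2304.03876 — 10 statements merged into one kernel-verified Lean document; each statement's English description precedes it below -/
import Mathlib

section
/- Let (X,d) be a metric space and let u, v ∈ F¹_USC(X). Then (i) H_end(u,v) ≤ H_send(u,v); (ii) H([u]_0, [v]_0) ≤ H_send(u,v); and (iii) if H_end(u,v) < 1, then H_send(u,v) ≤ H_end(u,v) + H([u]_0, [v]_0). -/
open Set Filter Topology MeasureTheory
open scoped ENNReal NNReal

noncomputable section

/-- `sup_{a ∈ A} inf_{b ∈ B} ρ a b`, valued in `ℝ≥0∞`. -/
def hStar {Y : Type*} (ρ : Y → Y → ℝ≥0∞) (A B : Set Y) : ℝ≥0∞ :=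
  ⨆ a ∈ A, ⨅ b ∈ B, ρ a b

/-- Hausdorff (extended) distance with respect to the distance `ρ`:
`H(A,B) = max (H*(A,B)) (H*(B,A))`. -/
def hDist {Y : Type*} (ρ : Y → Y → ℝ≥0∞) (A B : Set Y) : ℝ≥0∞ :=
  max (hStar ρ A B) (hStar ρ B A)

/-- Kuratowski lower limit of a sequence of sets. -/
def KurLiminf {Y : Type*} [TopologicalSpace Y] (C : ℕ → Set Y) : Set Y :=
  {y | ∃ f : ℕ → Y, (∀ n, f n ∈ C n) ∧ Tendsto f atTop (𝓝 y)}

/-- Kuratowski upper limit of a sequence of sets. -/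
def KurLimsup {Y : Type*} [TopologicalSpace Y] (C : ℕ → Set Y) : Set Y :=
  {y | ∃ φ : ℕ → ℕ, StrictMono φ ∧ ∃ f : ℕ → Y,
      (∀ k, f k ∈ C (φ k)) ∧ Tendsto f atTop (𝓝 y)}

/-- Kuratowski convergence of a sequence of sets to a set. -/
def KurConv {Y : Type*} [TopologicalSpace Y] (C : ℕ → Set Y) (L : Set Y) : Prop :=
  KurLiminf C = L ∧ KurLimsup C = L

/-- A set `P` is dense in the set `S` (in particular `P ⊆ S`). -/
def DenseIn {Y : Type*} [TopologicalSpace Y] (P S : Set Y) : Prop :=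
  P ⊆ S ∧ S ⊆ closure P

variable {X : Type*} [MetricSpace X]

/-- Hausdorff distance `H*` between subsets of the metric space `X`. -/
def HXstar (A B : Set X) : ℝ≥0∞ := hStar edist A B

/-- Hausdorff distance `H` between subsets of the metric space `X`. -/
def HXdist (A B : Set X) : ℝ≥0∞ := hDist edist A B

/-- The metric `d̄` on `X × [0,1]` (modelled on `X × ℝ`):
`d̄((x,α),(y,β)) = d(x,y) + |α - β|`. -/
def dbar (p q : X × ℝ) : ℝ≥0∞ := edist p.1 q.1 + edist p.2 q.2

/-- `H*` for subsets of `(X × [0,1], d̄)`. -/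
def HPstar (A B : Set (X × ℝ)) : ℝ≥0∞ := hStar dbar A B

/-- Hausdorff distance for subsets of `(X × [0,1], d̄)`. -/
def HPdist (A B : Set (X × ℝ)) : ℝ≥0∞ := hDist dbar A B

/-- The α-cut of a fuzzy set `u : X → ℝ`:  `[u]_α = {x | u x ≥ α}` for `α ≠ 0`, and
`[u]_0 = closure {x | u x > 0}`. -/
def acut (u : X → ℝ) (α : ℝ) : Set X :=
  if α = 0 then closure {x | 0 < u x} else {x | α ≤ u x}

/-- The endograph of `u`: `{(x,t) ∈ X × [0,1] : u x ≥ t}`. -/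
def endograph (u : X → ℝ) : Set (X × ℝ) :=
  {p : X × ℝ | p.2 ∈ Icc (0:ℝ) 1 ∧ p.2 ≤ u p.1}

/-- The sendograph of `u`: `end u ∩ ([u]_0 × [0,1])`. -/
def sendograph (u : X → ℝ) : Set (X × ℝ) :=
  endograph u ∩ ((acut u 0) ×ˢ (Icc (0:ℝ) 1))

/-- `F¹_USC(X)`: normal upper semicontinuous fuzzy sets with values in `[0,1]`, i.e. all
α-cuts (`α ∈ [0,1]`) are nonempty and closed. -/
def FUSC (u : X → ℝ) : Prop :=
  (∀ x, u x ∈ Icc (0:ℝ) 1) ∧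
    ∀ α ∈ Icc (0:ℝ) 1, (acut u α).Nonempty ∧ IsClosed (acut u α)

/-- `F¹_USCG(X)`: members of `F¹_USC(X)` whose α-cuts are compact for `α ∈ (0,1]`. -/
def FUSCG (u : X → ℝ) : Prop :=
  FUSC u ∧ ∀ α ∈ Ioc (0:ℝ) 1, IsCompact (acut u α)

/-- `F¹_USCB(X)`: members of `F¹_USC(X)` whose 0-cut is compact. -/
def FUSCB (u : X → ℝ) : Prop :=
  FUSC u ∧ IsCompact (acut u 0)

/-- The endograph metric `H_end`. -/
def Hend (u v : X → ℝ) : ℝ≥0∞ := HPdist (endograph u) (endograph v)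

/-- The sendograph metric `H_send`. -/
def Hsend (u v : X → ℝ) : ℝ≥0∞ := HPdist (sendograph u) (sendograph v)

/-- Γ-convergence: Kuratowski convergence of the endographs in `X × [0,1]`. -/
def GammaConv (un : ℕ → X → ℝ) (u : X → ℝ) : Prop :=
  KurConv (fun n => endograph (un n)) (endograph u)

/-- `P(u)`: the set of `α ∈ (0,1)` such that `closure {u > α}` is a proper subset of `[u]_α`. -/
def Pset (u : X → ℝ) : Set ℝ :=
  {α ∈ Ioo (0:ℝ) 1 | closure {x | α < u x} ⊂ acut u α}

/-- `D(u)`: the set of `α ∈ (0,1)` such that `[u]_α ⊄ closure {u > α}`. -/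
def Dset (u : X → ℝ) : Set ℝ :=
  {α ∈ Ioo (0:ℝ) 1 | ¬ acut u α ⊆ closure {x | α < u x}}

/-- `P₀(u) = (0,1) \ {α ∈ (0,1) : lim_{β → α} H([u]_β , [u]_α) = 0}`. -/
def P0set (u : X → ℝ) : Set ℝ :=
  Ioo (0:ℝ) 1 \
    {α | Tendsto (fun β => HXdist (acut u β) (acut u α)) (𝓝[Icc (0:ℝ) 1] α) (𝓝 0)}

/-- The `d_p^*` distance on fuzzy sets. -/
def dpstar (p : ℝ) (u v : X → ℝ) : ℝ≥0∞ :=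
  ⨅ f ∈ {f : ℝ → ℝ≥0∞ | Measurable f ∧
      ∀ α ∈ Icc (0:ℝ) 1, HXdist (acut u α) (acut v α) ≤ f α},
    (∫⁻ α in Icc (0:ℝ) 1, f α ^ p) ^ (1 / p)


theorem acut_zero (u : X → ℝ) : acut u 0 = closure {x | 0 < u x} := if_pos rfl

theorem biInf_le_hStar {Y : Type*} {ρ : Y → Y → ℝ≥0∞} {A B : Set Y} {a : Y} (ha : a ∈ A) :
    ⨅ b ∈ B, ρ a b ≤ hStar ρ A B :=
  le_iSup₂ (f := fun a _ => ⨅ b ∈ B, ρ a b) a ha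

theorem mem_sendograph_of_pos {u : X → ℝ} {p : X × ℝ} (hp : p ∈ endograph u) (h : 0 < p.2) :
    p ∈ sendograph u :=
  ⟨hp, by rw [acut_zero]; exact subset_closure (h.trans_le hp.2), hp.1⟩

theorem mk_zero_mem_endograph {u : X → ℝ} (hu : FUSC u) (x : X) : (x, (0 : ℝ)) ∈ endograph u :=
  ⟨⟨le_rfl, zero_le_one⟩, (hu.1 x).1⟩

theorem mk_zero_mem_sendograph {u : X → ℝ} (hu : FUSC u) {x : X} (hx : x ∈ acut u 0) :
    (x, (0 : ℝ)) ∈ sendograph u :=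
  ⟨mk_zero_mem_endograph hu x, hx, le_rfl, zero_le_one⟩

theorem HPstar_endograph_le (u : X → ℝ) {v : X → ℝ} (hv : FUSC v) :
    HPstar (endograph u) (endograph v) ≤ HPstar (sendograph u) (sendograph v) := by
  refine iSup₂_le fun p hp => ?_
  rcases hp.1.1.eq_or_lt with h | h
  · have hpv : p ∈ endograph v := by
      have := mk_zero_mem_endograph hv p.1
      rwa [h] at this
    exact (iInf₂_le p hpv).trans (by simp [dbar])
  · exact (biInf_mono fun q hq => hq.1).trans (biInf_le_hStar (mem_sendograph_of_pos hp h))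

theorem HXstar_acut_zero_le {u : X → ℝ} (hu : FUSC u) (v : X → ℝ) :
    HXstar (acut u 0) (acut v 0) ≤ HPstar (sendograph u) (sendograph v) := by
  refine iSup₂_le fun x hx => ?_
  refine le_trans ?_ (biInf_le_hStar (mk_zero_mem_sendograph hu hx))
  exact le_iInf₂ fun q hq => (iInf₂_le q.1 hq.2.1).trans le_self_add

theorem HPstar_sendograph_le (u : X → ℝ) {v : X → ℝ} (hv : FUSC v) :
    HPstar (sendograph u) (sendograph v) ≤
      HPstar (endograph u) (endograph v) + HXstar (acut u 0) (acut v 0) := by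
  refine iSup₂_le fun p hp => ?_
  refine le_trans ?_ (add_le_add (biInf_le_hStar hp.1) (biInf_le_hStar hp.2.1))
  simp only [ENNReal.iInf_add, ENNReal.add_iInf]
  refine le_iInf₂ fun z hz => le_iInf₂ fun q hq => ?_
  rcases hq.1.1.eq_or_lt with h | h
  · refine (iInf₂_le _ (mk_zero_mem_sendograph hv hz)).trans ?_
    simp only [dbar, ← h]
    rw [add_comm]
    gcongr
    exact le_add_self
  · exact (iInf₂_le q (mem_sendograph_of_pos hq h)).trans le_self_add

/-- relations between `H_end`, `H_send` and the Hausdorff distance of 0-cuts. -/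
theorem stmt0 (u v : X → ℝ) (hu : FUSC u) (hv : FUSC v) :
    Hend u v ≤ Hsend u v ∧
    HXdist (acut u 0) (acut v 0) ≤ Hsend u v ∧
    (Hend u v < 1 →
      Hsend u v ≤ Hend u v + HXdist (acut u 0) (acut v 0)) := by
  refine ⟨max_le_max (HPstar_endograph_le u hv) (HPstar_endograph_le v hu),
    max_le_max (HXstar_acut_zero_le hu v) (HXstar_acut_zero_le hv u), fun _ => max_le ?_ ?_⟩
  · exact (HPstar_sendograph_le u hv).trans (add_le_add (le_max_left _ _) (le_max_left _ _))
  · exact (HPstar_sendograph_le v hu).trans (add_le_add (le_max_right _ _) (le_max_right _ _))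

end
end

section
/- Let (X,d) be a metric space and let u, u_1, u_2, … be fuzzy sets in F¹_USC(X). Then the sequence of sendographs send u_n Kuratowski converges to send u in (X × [0,1], d̄) if and only if u_n Γ-converges to u and [u_n]_0 Kuratowski converges to [u]_0 in (X,d). -/
open Set Filter Topology MeasureTheory
open scoped ENNReal NNReal

noncomputable section

variable {X : Type*} [MetricSpace X]

theorem mem_kurLiminf_of_eventually {Y : Type*} [TopologicalSpace Y] {C : ℕ → Set Y}
    (hC : ∀ n, (C n).Nonempty) {f : ℕ → Y} {y : Y} (hf : ∀ᶠ n in atTop, f n ∈ C n)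
    (hy : Tendsto f atTop (𝓝 y)) : y ∈ KurLiminf C := by
  classical
  choose c hc using hC
  refine ⟨fun n => if f n ∈ C n then f n else c n, fun n => ?_, hy.congr' ?_⟩
  · by_cases h : f n ∈ C n
    · simp [h]
    · simp [h, hc]
  · filter_upwards [hf] with n hn
    simp [hn]

theorem mem_kurLimsup_of_eventually {Y : Type*} [TopologicalSpace Y] {C : ℕ → Set Y}
    {φ : ℕ → ℕ} (hφ : StrictMono φ) {f : ℕ → Y} {y : Y}
    (hf : ∀ᶠ k in atTop, f k ∈ C (φ k)) (hy : Tendsto f atTop (𝓝 y)) : y ∈ KurLimsup C := by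
  obtain ⟨N, hN⟩ := eventually_atTop.1 hf
  exact ⟨fun k => φ (k + N), fun _ _ h => hφ (by lia), fun k => f (k + N),
    fun k => hN _ (by lia), (tendsto_add_atTop_iff_nat N).2 hy⟩

theorem kurConv_iff_subset {Y : Type*} [TopologicalSpace Y] {C : ℕ → Set Y} {L : Set Y} :
    KurConv C L ↔ L ⊆ KurLiminf C ∧ KurLimsup C ⊆ L := by
  have hle : KurLiminf C ⊆ KurLimsup C := fun _ ⟨f, hf, hy⟩ => ⟨id, strictMono_id, f, hf, hy⟩
  constructor
  · rintro ⟨h₁, h₂⟩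
    exact ⟨h₁.ge, h₂.le⟩
  · rintro ⟨h₁, h₂⟩
    exact ⟨(hle.trans h₂).antisymm h₁, h₂.antisymm (h₁.trans hle)⟩

theorem sendograph_nonempty {u : X → ℝ} (hu : FUSC u) : (sendograph u).Nonempty := by
  obtain ⟨x, hx⟩ := (hu.2 0 (by simp)).1
  exact ⟨_, mk_zero_mem_sendograph hu hx⟩

/-- Kuratowski convergence of sendographs iff Γ-convergence together with
Kuratowski convergence of the 0-cuts. -/
theorem stmt2 (u : X → ℝ) (un : ℕ → X → ℝ) (hu : FUSC u) (hun : ∀ n, FUSC (un n)) :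
    KurConv (fun n => sendograph (un n)) (sendograph u) ↔
      GammaConv un u ∧ KurConv (fun n => acut (un n) 0) (acut u 0) := by
  simp only [GammaConv, kurConv_iff_subset]
  constructor
  · rintro ⟨hinf, hsup⟩
    refine ⟨⟨?_, ?_⟩, ?_, ?_⟩
    · rintro ⟨x, t⟩ hp
      rcases hp.1.1.eq_or_lt with ht | ht
      · obtain rfl : 0 = t := ht
        exact ⟨fun _ => (x, 0), fun n => mk_zero_mem_endograph (hun n) x, tendsto_const_nhds⟩
      · obtain ⟨f, hf, hy⟩ := hinf (mem_sendograph_of_pos hp ht)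
        exact ⟨f, fun n => (hf n).1, hy⟩
    · rintro ⟨x, t⟩ ⟨φ, hφ, f, hf, hy⟩
      have hy₂ : Tendsto (fun k => (f k).2) atTop (𝓝 t) := hy.snd_nhds
      rcases (ge_of_tendsto' hy₂ fun k => (hf k).1.1).eq_or_lt with ht | ht
      · obtain rfl : 0 = t := ht
        exact mk_zero_mem_endograph hu x
      · refine (hsup (mem_kurLimsup_of_eventually hφ ?_ hy)).1
        filter_upwards [hy₂.eventually_const_lt ht] with k hk
        exact mem_sendograph_of_pos (hf k) hk
    · intro x hx
      obtain ⟨f, hf, hy⟩ := hinf (mk_zero_mem_sendograph hu hx)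
      exact ⟨fun n => (f n).1, fun n => (hf n).2.1, hy.fst_nhds⟩
    · rintro x ⟨φ, hφ, f, hf, hy⟩
      have hx : (x, (0 : ℝ)) ∈ sendograph u :=
        hsup ⟨φ, hφ, fun k => (f k, 0), fun k => mk_zero_mem_sendograph (hun _) (hf k),
          hy.prodMk_nhds tendsto_const_nhds⟩
      exact hx.2.1
  · rintro ⟨⟨hinf, hsup⟩, hinf₀, hsup₀⟩
    constructor
    · rintro ⟨x, t⟩ hp
      rcases hp.1.1.1.eq_or_lt with ht | ht
      · obtain rfl : 0 = t := ht
        obtain ⟨f, hf, hy⟩ := hinf₀ hp.2.1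
        exact ⟨fun n => (f n, 0), fun n => mk_zero_mem_sendograph (hun n) (hf n),
          hy.prodMk_nhds tendsto_const_nhds⟩
      · obtain ⟨f, hf, hy⟩ := hinf hp.1
        refine mem_kurLiminf_of_eventually (fun n => sendograph_nonempty (hun n)) ?_ hy
        filter_upwards [hy.snd_nhds.eventually_const_lt ht] with n hn
        exact mem_sendograph_of_pos (hf n) hn
    · rintro ⟨x, t⟩ ⟨φ, hφ, f, hf, hy⟩
      have hp : (x, t) ∈ endograph u := hsup ⟨φ, hφ, f, fun k => (hf k).1, hy⟩
      have hx : x ∈ acut u 0 :=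
        hsup₀ ⟨φ, hφ, fun k => (f k).1, fun k => (hf k).2.1, hy.fst_nhds⟩
      exact ⟨hp, hx, hp.1⟩

end
end

section
/- Let (X,d) be a metric space and let u, u_1, u_2, … be fuzzy sets in F¹_USC(X). Then u_n Γ-converges to u if and only if for all α ∈ (0,1]: the closure of {x : u(x) > α} ⊆ liminf_n [u_n]_α ⊆ limsup_n [u_n]_α ⊆ [u]_α. -/
open Set Filter Topology MeasureTheory
open scoped ENNReal NNReal

noncomputable section

variable {X : Type*} [MetricSpace X]

theorem mem_KurLiminf_iff {Y : Type*} [PseudoMetricSpace Y] {C : ℕ → Set Y}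
    (hC : ∀ n, (C n).Nonempty) {y : Y} :
    y ∈ KurLiminf C ↔ ∀ U ∈ 𝓝 y, ∀ᶠ n in atTop, (U ∩ C n).Nonempty := by
  constructor
  · rintro ⟨f, hf, hlim⟩ U hU
    filter_upwards [hlim hU] with n hn using ⟨f n, hn, hf n⟩
  · intro h
    have hex : ∀ n : ℕ, ∃ z ∈ C n, dist y z < Metric.infDist y (C n) + 1 / ((n : ℝ) + 1) :=
      fun n => (Metric.infDist_lt_iff (hC n)).1 (lt_add_of_pos_right _ (by positivity))
    choose f hf hfd using hex
    refine ⟨f, hf, ?_⟩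
    rw [Metric.tendsto_atTop']
    intro ε hε
    obtain ⟨N, hN⟩ := eventually_atTop.1 ((h _ (Metric.ball_mem_nhds y (half_pos hε))).and
      (tendsto_one_div_add_atTop_nhds_zero_nat.eventually (gt_mem_nhds (half_pos hε))))
    refine ⟨N, fun n hn => ?_⟩
    obtain ⟨⟨z, hz, hzC⟩, hn'⟩ := hN n hn.le
    have hle := Metric.infDist_le_dist_of_mem (x := y) hzC
    rw [Metric.mem_ball, dist_comm] at hz
    rw [dist_comm]
    linarith [hfd n]

theorem mem_KurLimsup_iff {Y : Type*} [PseudoMetricSpace Y] {C : ℕ → Set Y} {y : Y} :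
    y ∈ KurLimsup C ↔ ∀ U ∈ 𝓝 y, ∃ᶠ n in atTop, (U ∩ C n).Nonempty := by
  constructor
  · rintro ⟨φ, hφ, f, hf, hlim⟩ U hU
    refine hφ.tendsto_atTop.frequently (Eventually.frequently ?_)
    filter_upwards [hlim hU] with k hk using ⟨f k, hk, hf k⟩
  · intro h
    obtain ⟨φ, hφ, hne⟩ := extraction_forall_of_frequently fun n : ℕ =>
      h _ (Metric.ball_mem_nhds y (Nat.one_div_pos_of_nat (α := ℝ) (n := n)))
    choose f hf using hne
    refine ⟨φ, hφ, f, fun k => (hf k).2, ?_⟩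
    rw [tendsto_iff_dist_tendsto_zero]
    exact squeeze_zero (fun _ => dist_nonneg) (fun k => (Metric.mem_ball.1 (hf k).1).le)
      tendsto_one_div_add_atTop_nhds_zero_nat

theorem KurLiminf_subset_KurLimsup {Y : Type*} [TopologicalSpace Y] (C : ℕ → Set Y) :
    KurLiminf C ⊆ KurLimsup C :=
  fun _ ⟨f, hf, hlim⟩ => ⟨id, strictMono_id, f, hf, hlim⟩

theorem isClosed_KurLiminf {Y : Type*} [PseudoMetricSpace Y] {C : ℕ → Set Y}
    (hC : ∀ n, (C n).Nonempty) : IsClosed (KurLiminf C) := by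
  refine isClosed_of_closure_subset fun y hy => (mem_KurLiminf_iff hC).2 fun U hU => ?_
  obtain ⟨z, hzU, hz⟩ := mem_closure_iff_nhds.1 hy _ (interior_mem_nhds.2 hU)
  exact (mem_KurLiminf_iff hC).1 hz U (mem_interior_iff_mem_nhds.1 hzU)

theorem mem_acut_of_pos {u : X → ℝ} {α : ℝ} (hα : 0 < α) {x : X} :
    x ∈ acut u α ↔ α ≤ u x := by
  simp [acut, hα.ne']

/-- level characterization of Γ-convergence. -/
theorem stmt3 (u : X → ℝ) (un : ℕ → X → ℝ) (hu : FUSC u) (hun : ∀ n, FUSC (un n)) :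
    GammaConv un u ↔
      ∀ α ∈ Ioc (0:ℝ) 1,
        closure {x | α < u x} ⊆ KurLiminf (fun n => acut (un n) α) ∧
        KurLiminf (fun n => acut (un n) α) ⊆ KurLimsup (fun n => acut (un n) α) ∧
        KurLimsup (fun n => acut (un n) α) ⊆ acut u α := by
  constructor
  · rintro ⟨hinf, hsup⟩ α hα
    have hcut : ∀ n, (acut (un n) α).Nonempty := fun n => ((hun n).2 α ⟨hα.1.le, hα.2⟩).1
    refine ⟨closure_minimal (fun x hx => ?_) (isClosed_KurLiminf hcut),
      KurLiminf_subset_KurLimsup _, ?_⟩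
    · have hmem : (x, u x) ∈ KurLiminf (fun n => endograph (un n)) :=
        hinf ▸ ⟨hu.1 x, le_rfl⟩
      obtain ⟨f, hf, hlim⟩ := hmem
      refine (mem_KurLiminf_iff hcut).2 fun U hU => ?_
      filter_upwards [hlim (prod_mem_nhds hU (Ioi_mem_nhds hx))] with n hn
      exact ⟨(f n).1, hn.1, (mem_acut_of_pos hα.1).2 ((le_of_lt hn.2).trans (hf n).2)⟩
    · rintro x ⟨φ, hφ, f, hf, hlim⟩
      have hmem : (x, α) ∈ KurLimsup (fun n => endograph (un n)) :=
        ⟨φ, hφ, fun k => (f k, α),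
          fun k => ⟨⟨hα.1.le, hα.2⟩, (mem_acut_of_pos hα.1).1 (hf k)⟩,
          hlim.prodMk_nhds tendsto_const_nhds⟩
      rw [hsup] at hmem
      exact (mem_acut_of_pos hα.1).2 hmem.2
  · intro h
    have hlow : endograph u ⊆ KurLiminf (fun n => endograph (un n)) := by
      rintro ⟨x, t⟩ ⟨⟨ht0, ht1⟩, htu⟩
      dsimp only at ht0 ht1 htu
      have hend : ∀ n, (endograph (un n)).Nonempty :=
        fun n => ⟨(x, 0), ⟨le_rfl, zero_le_one⟩, ((hun n).1 x).1⟩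
      rcases ht0.eq_or_lt with rfl | ht
      · exact ⟨fun _ => (x, 0), fun n => ⟨⟨le_rfl, zero_le_one⟩, ((hun n).1 x).1⟩,
          tendsto_const_nhds⟩
      have hs : ∀ s ∈ Ioo 0 t, (x, s) ∈ KurLiminf (fun n => endograph (un n)) := by
        rintro s ⟨hs0, hst⟩
        have hs1 : s ≤ 1 := hst.le.trans ht1
        obtain ⟨f, hf, hlim⟩ := (h s ⟨hs0, hs1⟩).1 (subset_closure (hst.trans_le htu))
        exact ⟨fun n => (f n, s), fun n => ⟨⟨hs0.le, hs1⟩, (mem_acut_of_pos hs0).1 (hf n)⟩,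
          hlim.prodMk_nhds tendsto_const_nhds⟩
      have hlim : Tendsto (fun s => (x, s)) (𝓝[<] t) (𝓝 (x, t)) :=
        tendsto_const_nhds.prodMk_nhds nhdsWithin_le_nhds
      exact (isClosed_KurLiminf hend).mem_of_tendsto hlim
        (mem_of_superset (Ioo_mem_nhdsLT ht) hs)
    have hupp : KurLimsup (fun n => endograph (un n)) ⊆ endograph u := by
      rintro ⟨x, t⟩ hxt
      have htI : t ∈ Icc (0 : ℝ) 1 := by
        obtain ⟨φ, -, f, hf, hlim⟩ := hxt
        exact isClosed_Icc.mem_of_tendsto hlim.snd_nhds (Eventually.of_forall fun k => (hf k).1)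
      refine ⟨htI, le_of_forall_lt fun s hst => ?_⟩
      dsimp only at hst ⊢
      by_contra! hus
      obtain ⟨r, hsr, hrt⟩ := exists_between hst
      have hr0 : 0 < r := ((hu.1 x).1.trans hus).trans_lt hsr
      refine absurd ((mem_acut_of_pos hr0).1 ((h r ⟨hr0, hrt.le.trans htI.2⟩).2.2
        (mem_KurLimsup_iff.2 fun U hU => ?_))) (hus.trans_lt hsr).not_ge
      refine (mem_KurLimsup_iff.1 hxt _ (prod_mem_nhds hU (Ioi_mem_nhds hrt))).mono ?_
      rintro n ⟨p, ⟨hpU, hpr⟩, hp⟩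
      exact ⟨p.1, hpU, (mem_acut_of_pos hr0).2 ((le_of_lt hpr).trans hp.2)⟩
    exact ⟨((KurLiminf_subset_KurLimsup _).trans hupp).antisymm hlow,
      hupp.antisymm (hlow.trans (KurLiminf_subset_KurLimsup _))⟩

end
end

section
/- Let (X,d) be a metric space and let u : X → [0,1] be any fuzzy set on X. If the subspace ([u]_0, d) is separable, then the set D(u) = {α ∈ (0,1) : [u]_α is not contained in the closure of {x : u(x) > α}} is countable. -/
open Set Filter Topology MeasureTheory
open scoped ENNReal NNReal

noncomputable section

variable {X : Type*} [MetricSpace X]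

/-- In a second countable space, a real function has only countably many local maximum values. -/
theorem countable_setOf_isLocalMax_values {Y : Type*} [TopologicalSpace Y]
    [SecondCountableTopology Y] (f : Y → ℝ) : {a | ∃ y, IsLocalMax f y ∧ f y = a}.Countable := by
  refine ((TopologicalSpace.countable_countableBasis Y).image fun B => sSup (f '' B)).mono ?_
  rintro _ ⟨y, hy, rfl⟩
  obtain ⟨B, hB, hyB, hBf⟩ :=
    (TopologicalSpace.isBasis_countableBasis Y).mem_nhds_iff.1 hy
  refine ⟨B, hB, IsGreatest.csSup_eq ⟨mem_image_of_mem f hyB, ?_⟩⟩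
  rintro _ ⟨z, hz, rfl⟩
  exact hBf hz

/-- if `([u]_0, d)` is separable then `D(u)` is countable. -/
theorem stmt4 (u : X → ℝ) (hu : ∀ x, u x ∈ Icc (0:ℝ) 1)
    (hsep : TopologicalSpace.IsSeparable (acut u 0)) :
    (Dset u).Countable := by
  have := hsep.separableSpace
  have := UniformSpace.secondCountable_of_separable (acut u 0)
  refine (countable_setOf_isLocalMax_values fun x : acut u 0 => u x).mono ?_
  rintro α ⟨hα, hcut⟩
  obtain ⟨x, hx, hxcl⟩ := not_subset.1 hcut
  rw [acut, if_neg hα.1.ne', mem_ofPred_eq] at hx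
  have hux : u x = α := le_antisymm (not_lt.1 fun h => hxcl (subset_closure h)) hx
  have hx0 : x ∈ acut u 0 := by
    rw [acut, if_pos rfl]
    exact subset_closure (hα.1.trans_le hx)
  have hmax : IsLocalMax u x := by
    filter_upwards [isClosed_closure.isOpen_compl.mem_nhds hxcl] with z hz
    rw [hux]
    exact not_lt.1 fun h => hz (subset_closure h)
  exact ⟨⟨x, hx0⟩, hmax.comp_continuous (g := Subtype.val) (b := ⟨x, hx0⟩) continuous_subtype_val.continuousAt, hux⟩

end
end

section
/- Let (X,d) be a metric space and let u ∈ F¹_USCG(X). Then: (i) for each α ∈ (0,1], lim_{β→α⁻} H([u]_β, [u]_α) = 0; (ii) for each α ∈ (0,1), lim_{γ→α⁺} H([u]_γ, cl{u>α}) = 0, where cl{u>α} is the closure of {x : u(x) > α}; (iii) P(u) = P_0(u); (iv) P_0(u) is countable; (v) if moreover u ∈ F¹_USCB(X), then lim_{γ→0⁺} H([u]_γ, [u]_0) = 0. -/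
open Set Filter Topology MeasureTheory
open scoped ENNReal NNReal

noncomputable section

variable {X : Type*} [MetricSpace X]

lemma HXstar_le_iff {A B : Set X} {ε : ℝ≥0∞} :
    HXstar A B ≤ ε ↔ ∀ a ∈ A, Metric.infEDist a B ≤ ε :=
  iSup₂_le_iff

lemma HXdist_le_iff_of_subset {A B : Set X} {ε : ℝ≥0∞} (h : A ⊆ B) :
    HXdist A B ≤ ε ↔ ∀ b ∈ B, Metric.infEDist b A ≤ ε := by
  have h_zero : HXstar A B ≤ ε :=
    HXstar_le_iff.2 fun a ha => (Metric.infEDist_zero_of_mem (h ha)).le.trans zero_le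
  exact max_le_iff.trans ((and_iff_right h_zero).trans HXstar_le_iff)

lemma HXdist_comm (A B : Set X) : HXdist A B = HXdist B A :=
  max_comm _ _

lemma HXdist_self (A : Set X) : HXdist A A = 0 :=
  le_antisymm ((HXdist_le_iff_of_subset Subset.rfl).2 fun _ ha =>
    (Metric.infEDist_zero_of_mem ha).le) zero_le

lemma infEDist_le_HXdist {A B : Set X} {b : X} (hb : b ∈ B) :
    Metric.infEDist b A ≤ HXdist A B :=
  HXstar_le_iff.1 (le_max_right (HXstar A B) (HXstar B A)) b hb

lemma acut_of_pos {u : X → ℝ} {α : ℝ} (h : 0 < α) : acut u α = {x | α ≤ u x} :=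
  if_neg h.ne'

lemma FUSC.upperSemicontinuous {u : X → ℝ} (hu : FUSC u) : UpperSemicontinuous u := by
  rw [upperSemicontinuous_iff_isClosed_preimage]
  intro α
  rcases le_or_gt α 0 with h | h
  · convert isClosed_univ
    exact eq_univ_of_forall fun x => h.trans (hu.1 x).1
  rcases le_or_gt α 1 with h1 | h1
  · have := (hu.2 α ⟨h.le, h1⟩).2
    rwa [acut_of_pos h] at this
  · convert isClosed_empty
    exact eq_empty_of_forall_notMem fun x hx => (h1.trans_le hx).not_ge (hu.1 x).2

lemma FUSCG.isCompact_setOf_le {u : X → ℝ} (hu : FUSCG u) {α : ℝ} (hα : α ∈ Ioc (0:ℝ) 1) :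
    IsCompact {x | α ≤ u x} :=
  acut_of_pos (u := u) hα.1 ▸ hu.2 α hα

lemma FUSC.closure_setOf_lt_subset {u : X → ℝ} (hu : FUSC u) (α : ℝ) :
    closure {x | α < u x} ⊆ {x | α ≤ u x} :=
  closure_minimal (fun x (hx : α < u x) => hx.le)
    (upperSemicontinuous_iff_isClosed_preimage.1 hu.upperSemicontinuous α)

/-- Superlevel sets of an upper semicontinuous function are left continuous for the Hausdorff
distance, as soon as one of the lower ones is compact. -/
lemma tendsto_HXdist_setOf_le_nhdsLT {u : X → ℝ} (hu : UpperSemicontinuous u) {α₀ α : ℝ}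
    (h : α₀ < α) (hK : IsCompact {x | α₀ ≤ u x}) :
    Tendsto (fun β => HXdist {x | β ≤ u x} {x | α ≤ u x}) (𝓝[<] α) (𝓝 0) := by
  rw [ENNReal.tendsto_nhds_zero]
  intro ε hε
  set V : Set X := {x | Metric.infEDist x {x | α ≤ u x} < ε}
  have hV : IsOpen V := isOpen_lt Metric.continuous_infEDist continuous_const
  have : Nonempty (Iio α) := ⟨⟨α₀, h⟩⟩
  obtain ⟨⟨β₀, hβ₀⟩, hsub⟩ := hK.elim_directed_cover
    (fun β : Iio α => V ∪ {x | u x < β})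
    (fun β => hV.union (upperSemicontinuous_iff_isOpen_preimage.1 hu β))
    (fun x _ => by
      rcases lt_or_ge (u x) α with hx | hx
      · obtain ⟨β, h1, h2⟩ := exists_between hx
        exact mem_iUnion.2 ⟨⟨β, h2⟩, Or.inr h1⟩
      · refine mem_iUnion.2 ⟨⟨α₀, h⟩, Or.inl ?_⟩
        exact (Metric.infEDist_zero_of_mem (show x ∈ {x | α ≤ u x} from hx)).trans_lt hε)
    (Monotone.directed_le fun β γ hβγ => union_subset_union_right _
      fun x (hx : u x < β) => hx.trans_le hβγ)
  filter_upwards [Ioo_mem_nhdsLT (max_lt h hβ₀)] with β hβ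
  obtain ⟨h1, h2⟩ := max_lt_iff.1 hβ.1
  have hαβ : {x | α ≤ u x} ⊆ {x | β ≤ u x} := fun x (hx : α ≤ u x) => hβ.2.le.trans hx
  rw [HXdist_comm, HXdist_le_iff_of_subset hαβ]
  intro x hx
  rcases hsub (h1.le.trans hx) with hxV | hxu
  · exact le_of_lt hxV
  · exact absurd (hxu.trans h2) (not_lt.2 hx)

/-- Superlevel sets converge from the right to the closure of the strict superlevel set, as soon
as this closure is compact. -/
lemma tendsto_HXdist_setOf_le_nhdsGT {u : X → ℝ} {α : ℝ} (hK : IsCompact (closure {x | α < u x})) :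
    Tendsto (fun γ => HXdist {x | γ ≤ u x} (closure {x | α < u x})) (𝓝[>] α) (𝓝 0) := by
  rw [ENNReal.tendsto_nhds_zero]
  intro ε hε
  have : Nonempty (Ioi α) := ⟨⟨α + 1, by simp⟩⟩
  obtain ⟨⟨γ₀, hγ₀⟩, hsub⟩ := hK.elim_directed_cover
    (fun γ : Ioi α => {x | Metric.infEDist x {x | γ ≤ u x} < ε})
    (fun γ => isOpen_lt Metric.continuous_infEDist continuous_const)
    (fun x hx => by
      obtain ⟨y, hy, hxy⟩ := EMetric.mem_closure_iff.1 hx ε hε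
      exact mem_iUnion.2 ⟨⟨u y, hy⟩,
        (Metric.infEDist_le_edist_of_mem (show y ∈ {x | u y ≤ u x} from le_refl (u y))).trans_lt hxy⟩)
    (Antitone.directed_le fun β γ hβγ x hx =>
      (Metric.infEDist_anti (show {y | (γ : ℝ) ≤ u y} ⊆ {y | (β : ℝ) ≤ u y} from
        fun y (hy : (γ : ℝ) ≤ u y) => le_trans (Subtype.coe_le_coe.2 hβγ) hy)).trans_lt hx)
  filter_upwards [Ioc_mem_nhdsGT hγ₀] with γ hγ
  have hγα : {x | γ ≤ u x} ⊆ closure {x | α < u x} :=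
    fun x (hx : γ ≤ u x) => subset_closure (show α < u x from hγ.1.trans_le hx)
  have hγ₀γ : {x | γ₀ ≤ u x} ⊆ {x | γ ≤ u x} := fun x (hx : γ₀ ≤ u x) => hγ.2.trans hx
  rw [HXdist_le_iff_of_subset hγα]
  intro x hx
  exact (Metric.infEDist_anti hγ₀γ).trans (le_of_lt (hsub hx))

/-- A real function has only countably many local maximum values on a separable set. -/
lemma countable_image_isLocalMax {u : X → ℝ} {S : Set X} (hS : TopologicalSpace.IsSeparable S) :
    (u '' {x ∈ S | IsLocalMax u x}).Countable := by
  obtain ⟨c, hc, hSc⟩ := hS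
  refine ((hc.prod (countable_univ (α := ℕ))).image
    fun p => sSup (u '' Metric.ball p.1 (1 / (p.2 + 1)))).mono ?_
  rintro _ ⟨x, ⟨hxS, hx⟩, rfl⟩
  obtain ⟨δ, hδ, hball⟩ := Metric.eventually_nhds_iff_ball.1 hx
  obtain ⟨n, hn⟩ := exists_nat_one_div_lt (half_pos hδ)
  obtain ⟨y, hyc, hxy⟩ := Metric.mem_closure_iff.1 (hSc hxS) _ (Nat.one_div_pos_of_nat (n := n))
  refine ⟨(y, n), ⟨hyc, mem_univ _⟩, IsGreatest.csSup_eq ⟨mem_image_of_mem u hxy, ?_⟩⟩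
  rintro _ ⟨z, hz, rfl⟩
  refine hball z ?_
  have h1 : dist z y < 1 / ((n : ℝ) + 1) := hz
  have h2 := dist_triangle_right z x y
  rw [Metric.mem_ball]
  linarith

lemma FUSCG.tendsto_left {u : X → ℝ} (hu : FUSCG u) {α : ℝ} (hα : α ∈ Ioc (0:ℝ) 1) :
    Tendsto (fun β => HXdist (acut u β) (acut u α)) (𝓝[<] α) (𝓝 0) := by
  refine (tendsto_HXdist_setOf_le_nhdsLT hu.1.upperSemicontinuous (half_lt_self hα.1)
    (hu.isCompact_setOf_le ⟨half_pos hα.1, by linarith [hα.1, hα.2]⟩)).congr' ?_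
  filter_upwards [Ioo_mem_nhdsLT hα.1] with β hβ
  rw [acut_of_pos hβ.1, acut_of_pos hα.1]

lemma FUSCG.tendsto_right {u : X → ℝ} (hu : FUSCG u) {α : ℝ} (hα : α ∈ Ioo (0:ℝ) 1) :
    Tendsto (fun γ => HXdist (acut u γ) (closure {x | α < u x})) (𝓝[>] α) (𝓝 0) := by
  refine (tendsto_HXdist_setOf_le_nhdsGT ((hu.isCompact_setOf_le ⟨hα.1, hα.2.le⟩).of_isClosed_subset
    isClosed_closure (hu.1.closure_setOf_lt_subset α))).congr' ?_
  filter_upwards [self_mem_nhdsWithin] with γ hγ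
  rw [acut_of_pos (hα.1.trans hγ)]

lemma FUSCG.Pset_eq_P0set {u : X → ℝ} (hu : FUSCG u) : Pset u = P0set u := by
  ext α
  refine and_congr_right fun hα => ?_
  have hsub : closure {x | α < u x} ⊆ acut u α :=
    acut_of_pos (u := u) hα.1 ▸ hu.1.closure_setOf_lt_subset α
  have h_nhds : 𝓝[Icc (0:ℝ) 1] α = 𝓝 α := nhdsWithin_eq_nhds.2 (Icc_mem_nhds hα.1 hα.2)
  rw [mem_ofPred_eq, h_nhds]
  constructor
  · rintro ⟨-, hnot⟩ hlim
    obtain ⟨x, hx, hxc⟩ := not_subset.1 hnot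
    have hpos : 0 < Metric.infEDist x (closure {x | α < u x}) := by
      rw [pos_iff_ne_zero, ne_eq, ← Metric.mem_closure_iff_infEDist_zero, closure_closure]
      exact hxc
    have hev : ∀ᶠ γ in 𝓝[>] α,
        Metric.infEDist x (closure {x | α < u x}) ≤ HXdist (acut u γ) (acut u α) := by
      filter_upwards [self_mem_nhdsWithin] with γ hγ
      refine le_trans (Metric.infEDist_anti ?_) (infEDist_le_HXdist hx)
      rw [acut_of_pos (hα.1.trans hγ)]
      exact fun y (hy : γ ≤ u y) => subset_closure (show α < u y from lt_of_lt_of_le hγ hy)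
    exact hpos.not_ge (ge_of_tendsto (hlim.mono_left nhdsWithin_le_nhds) hev)
  · intro hlim
    refine ⟨hsub, fun hsup => hlim ?_⟩
    have hright := hu.tendsto_right hα
    rw [hsub.antisymm hsup] at hright
    have hpunctured : Tendsto (fun β => HXdist (acut u β) (acut u α)) (𝓝[≠] α) (𝓝 0) := by
      rw [← nhdsLT_sup_nhdsGT]
      exact (hu.tendsto_left ⟨hα.1, hα.2.le⟩).sup hright
    have hpure : Tendsto (fun β => HXdist (acut u β) (acut u α)) (pure α) (𝓝 0) :=
      (HXdist_self (acut u α)) ▸ tendsto_pure_nhds (fun β => HXdist (acut u β) (acut u α)) α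
    rw [← pure_sup_nhdsNE]
    exact hpure.sup hpunctured

lemma FUSCG.countable_Pset {u : X → ℝ} (hu : FUSCG u) : (Pset u).Countable := by
  have hsep : TopologicalSpace.IsSeparable {x | 0 < u x} := by
    refine (TopologicalSpace.IsSeparable.iUnion fun n : ℕ => (hu.isCompact_setOf_le
      ⟨Nat.one_div_pos_of_nat (n := n), ?_⟩).isSeparable).mono fun x (hx : 0 < u x) => ?_
    · exact div_le_one_of_le₀ (by simp) (by positivity)
    · obtain ⟨n, hn⟩ := exists_nat_one_div_lt hx
      exact mem_iUnion.2 ⟨n, hn.le⟩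
  refine (countable_image_isLocalMax (u := u) hsep).mono ?_
  rintro α ⟨hα, -, hnot⟩
  obtain ⟨x, hx, hxc⟩ := not_subset.1 hnot
  rw [acut_of_pos hα.1] at hx
  have hux : u x = α := le_antisymm (not_lt.1 fun h => hxc (subset_closure h)) hx
  refine ⟨x, ⟨show 0 < u x from hux ▸ hα.1, ?_⟩, hux⟩
  filter_upwards [isClosed_closure.isOpen_compl.mem_nhds hxc] with y hy
  exact hux ▸ not_lt.1 fun h => hy (subset_closure h)

/-- left/right continuity of the cut map of `u ∈ F¹_USCG(X)`, `P(u) = P₀(u)`,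
countability of `P₀(u)`, and right continuity at `0` in the compact-support case. -/
theorem stmt7 (u : X → ℝ) (hu : FUSCG u) :
    (∀ α ∈ Ioc (0:ℝ) 1,
        Tendsto (fun β => HXdist (acut u β) (acut u α)) (𝓝[Ico (0:ℝ) α] α) (𝓝 0)) ∧
    (∀ α ∈ Ioo (0:ℝ) 1,
        Tendsto (fun γ => HXdist (acut u γ) (closure {x | α < u x}))
          (𝓝[Ioc α 1] α) (𝓝 0)) ∧
    Pset u = P0set u ∧
    (P0set u).Countable ∧
    (FUSCB u →
      Tendsto (fun γ => HXdist (acut u γ) (acut u 0)) (𝓝[Ioc (0:ℝ) 1] 0) (𝓝 0)) := by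
  refine ⟨fun α hα => (hu.tendsto_left hα).mono_left (nhdsWithin_mono _ fun _ h => h.2),
    fun α hα => (hu.tendsto_right hα).mono_left (nhdsWithin_mono _ fun _ h => h.1),
    hu.Pset_eq_P0set, hu.Pset_eq_P0set ▸ hu.countable_Pset, fun hB => ?_⟩
  have h0 : acut u 0 = closure {x | 0 < u x} := if_pos rfl
  rw [h0]
  refine ((tendsto_HXdist_setOf_le_nhdsGT (h0 ▸ hB.2)).mono_left
    (nhdsWithin_mono _ fun _ h => h.1)).congr' ?_
  filter_upwards [self_mem_nhdsWithin] with γ hγ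
  rw [acut_of_pos hγ.1]

end
end

section
/- Let (X,d) be a metric space, let u, v ∈ F¹_USC(X), let ε ∈ (0,1], and let α, β ∈ [0,1] with α − β ≥ ε. If H*(end u, end v) < ε, then H*([u]_α, [v]_β) ≤ H*(end u, end v) < ε. -/
open Set Filter Topology MeasureTheory
open scoped ENNReal NNReal

noncomputable section

variable {X : Type*} [MetricSpace X]

/-- if `H*(end u, end v) < ε` and `α - β ≥ ε`, then
`H*([u]_α, [v]_β) ≤ H*(end u, end v) < ε`. -/
theorem stmt8 (u v : X → ℝ) (hu : FUSC u) (hv : FUSC v)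
    (ε : ℝ) (hε : ε ∈ Ioc (0:ℝ) 1)
    (α β : ℝ) (hα : α ∈ Icc (0:ℝ) 1) (hβ : β ∈ Icc (0:ℝ) 1) (hαβ : ε ≤ α - β)
    (h : HPstar (endograph u) (endograph v) < ENNReal.ofReal ε) :
    HXstar (acut u α) (acut v β) ≤ HPstar (endograph u) (endograph v) ∧
      HPstar (endograph u) (endograph v) < ENNReal.ofReal ε := by
  refine ⟨?_, h⟩
  refine iSup₂_le fun x hx => le_of_forall_gt fun c hc => ?_
  have hα0 : 0 < α := by linarith [hε.1, hβ.1]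
  have hxα : α ≤ u x := by simpa [acut, hα0.ne'] using hx
  have hmem : ((x, α) : X × ℝ) ∈ endograph u := ⟨hα, hxα⟩
  have hinf : ⨅ q ∈ endograph v, dbar (x, α) q < min c (ENNReal.ofReal ε) :=
    (le_iSup₂ (f := fun p (_ : p ∈ endograph u) => ⨅ q ∈ endograph v, dbar p q)
      (x, α) hmem).trans_lt (lt_min hc h)
  obtain ⟨⟨y, t⟩, hq, hlt⟩ := by simpa only [iInf_lt_iff, exists_prop] using hinf
  obtain ⟨hltc, hltε⟩ := lt_min_iff.mp hlt
  have hdist : dist α t < ε := by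
    rw [← edist_lt_ofReal]
    exact le_add_self.trans_lt hltε
  have hvy : β < v y := by
    have := (abs_lt.mp (Real.dist_eq α t ▸ hdist)).2
    have : t ≤ v y := hq.2
    linarith
  have hy : y ∈ acut v β := by
    unfold acut
    split_ifs with hβ0
    · exact subset_closure (hβ0 ▸ hvy)
    · exact hvy.le
  exact (iInf₂_le y hy).trans_lt (le_self_add.trans_lt hltc)

end
end

section
/- Let (X,d) be a metric space and let u, u_1, u_2, … be fuzzy sets in F¹_USC(X). If there is a dense subset P of (0,1) such that H([u_n]_α, [u]_α) → 0 for each α ∈ P, then H_end(u_n, u) → 0. -/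
open Set Filter Topology MeasureTheory
open scoped ENNReal NNReal

noncomputable section

variable {X : Type*} [MetricSpace X]

/-- If a set of levels approximates every level of `[ε, 1]` from below up to `ε`, and the cuts of `u`
at these levels are `ε`-close to those of `v`, then `end u` lies within `2ε` of `end v`. -/
theorem HPstar_endograph_le_s9 {u v : X → ℝ} {F : Set ℝ} {ε : ℝ} (hv : ∀ x, 0 ≤ v x)
    (hF : F ⊆ Ioo (0:ℝ) 1) (hcover : ∀ t ∈ Icc ε 1, ∃ α ∈ F, t ∈ Ioo α (α + ε))
    (hcut : ∀ α ∈ F, HXstar (acut u α) (acut v α) < ENNReal.ofReal ε) :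
    HPstar (endograph u) (endograph v) ≤ ENNReal.ofReal ε + ENNReal.ofReal ε := by
  refine iSup₂_le ?_
  rintro ⟨x, t⟩ ⟨⟨ht0, ht1⟩, htu⟩
  dsimp only at ht0 ht1 htu
  rcases le_total t ε with hε | hε
  · refine (iInf₂_le (x, 0) ⟨⟨le_rfl, zero_le_one⟩, hv x⟩).trans ?_
    have hdist : edist t 0 ≤ ENNReal.ofReal ε := by
      rw [edist_dist, Real.dist_eq, sub_zero, abs_of_nonneg ht0]
      exact ENNReal.ofReal_le_ofReal hε
    simpa [dbar] using hdist.trans le_self_add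
  · obtain ⟨α, hα, htα⟩ := hcover t ⟨hε, ht1⟩
    have hα0 : 0 < α := (hF hα).1
    have hx : x ∈ acut u α := by
      simpa [acut, hα0.ne'] using htα.1.le.trans htu
    have hlt : ⨅ b ∈ acut v α, edist x b < ENNReal.ofReal ε :=
      (le_iSup₂ (f := fun a (_ : a ∈ acut u α) => ⨅ b ∈ acut v α, edist a b) x hx).trans_lt
        (hcut α hα)
    obtain ⟨y, hy, hxy⟩ : ∃ y, ∃ _ : y ∈ acut v α, edist x y < ENNReal.ofReal ε := by
      simpa only [iInf_lt_iff] using hlt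
    have hyv : α ≤ v y := by simpa [acut, hα0.ne'] using hy
    refine (iInf₂_le (y, α) ⟨⟨hα0.le, (hF hα).2.le⟩, hyv⟩).trans (add_le_add hxy.le ?_)
    change edist t α ≤ _
    rw [edist_dist, Real.dist_eq, abs_of_nonneg (sub_nonneg.2 htα.1.le)]
    exact ENNReal.ofReal_le_ofReal (by linarith [htα.2])

/-- A dense subset of `(0, 1)` contains a finite set approximating every level of `[ε, 1]` from
below up to `ε`. -/
theorem DenseIn.exists_finite_approx {P : Set ℝ} (hP : DenseIn P (Ioo (0:ℝ) 1)) {ε : ℝ}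
    (hε : 0 < ε) :
    ∃ F ⊆ P, F.Finite ∧ ∀ t ∈ Icc ε 1, ∃ α ∈ F, t ∈ Ioo α (α + ε) := by
  obtain ⟨F, hFP, hF, hcover⟩ := (isCompact_Icc (a := ε) (b := 1)).elim_finite_subcover_image
    (b := P) (c := fun α => Ioo α (α + ε)) (fun _ _ => isOpen_Ioo) (fun t ht => by
      have hmid : t - ε / 2 ∈ closure P := hP.2 ⟨by linarith [ht.1], by linarith [ht.2]⟩
      obtain ⟨α, hα, hαP⟩ := mem_closure_iff.1 hmid (Ioo (t - ε) t) isOpen_Ioo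
        ⟨by linarith, by linarith⟩
      exact mem_biUnion hαP ⟨hα.2, by linarith [hα.1]⟩)
  exact ⟨F, hFP, hF, fun t ht => by simpa only [mem_iUnion₂, exists_prop] using hcover ht⟩

/-- Hausdorff convergence of α-cuts on a dense set of levels implies
`H_end` convergence. -/
theorem stmt9 (u : X → ℝ) (un : ℕ → X → ℝ) (hu : FUSC u) (hun : ∀ n, FUSC (un n))
    (P : Set ℝ) (hP : DenseIn P (Ioo (0:ℝ) 1))
    (h : ∀ α ∈ P, Tendsto (fun n => HXdist (acut (un n) α) (acut u α)) atTop (𝓝 0)) :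
    Tendsto (fun n => Hend (un n) u) atTop (𝓝 0) := by
  refine ENNReal.tendsto_nhds_zero.2 fun δ hδ => ?_
  obtain ⟨r, hr, hrδ⟩ := ENNReal.lt_iff_exists_nnreal_btwn.1 hδ
  have hε : 0 < (r : ℝ) / 2 := half_pos (by exact_mod_cast hr)
  obtain ⟨F, hFP, hF, hcover⟩ := hP.exists_finite_approx hε
  have hclose : ∀ᶠ n in atTop, ∀ α ∈ F,
      HXdist (acut (un n) α) (acut u α) < ENNReal.ofReal (r / 2) :=
    (eventually_all_finite hF).2 fun α hα =>
      (h α (hFP hα)).eventually_lt_const (ENNReal.ofReal_pos.2 hε)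
  have hsum : ENNReal.ofReal ((r : ℝ) / 2) + ENNReal.ofReal (r / 2) = r := by
    rw [← ENNReal.ofReal_add hε.le hε.le, add_halves, ENNReal.ofReal_coe_nnreal]
  filter_upwards [hclose] with n hn
  refine le_trans (max_le ?_ ?_) (hsum.trans_le hrδ.le)
  · exact HPstar_endograph_le_s9 (fun x => (hu.1 x).1) (hFP.trans hP.1) hcover
      fun α hα => (le_max_left _ _).trans_lt (hn α hα)
  · exact HPstar_endograph_le_s9 (fun x => ((hun n).1 x).1) (hFP.trans hP.1) hcover
      fun α hα => (le_max_right _ _).trans_lt (hn α hα)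

end
end

section
/- Let (X,d) be a metric space and let u, u_1, u_2, … be fuzzy sets in F¹_USC(X). If H_end(u_n, u) → 0, then H([u_n]_α, [u]_α) → 0 for each α ∈ (0,1) \ P_0(u). -/
open Set Filter Topology MeasureTheory
open scoped ENNReal NNReal

noncomputable section

variable {X : Type*} [MetricSpace X]

theorem exists_lt_of_hStar_lt {Y : Type*} {ρ : Y → Y → ℝ≥0∞} {A B : Set Y} {c : ℝ≥0∞}
    (h : hStar ρ A B < c) {a : Y} (ha : a ∈ A) : ∃ b ∈ B, ρ a b < c := by
  have h1 : ⨅ b ∈ B, ρ a b < c :=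
    lt_of_le_of_lt (le_iSup₂ (f := fun a (_ : a ∈ A) => ⨅ b ∈ B, ρ a b) a ha) h
  simpa [iInf_lt_iff] using h1

theorem hStar_le_of_forall_exists {Y : Type*} {ρ : Y → Y → ℝ≥0∞} {A B : Set Y} {c : ℝ≥0∞}
    (h : ∀ a ∈ A, ∃ b ∈ B, ρ a b ≤ c) : hStar ρ A B ≤ c := by
  refine iSup₂_le fun a ha => ?_
  obtain ⟨b, hb, hab⟩ := h a ha
  exact (iInf₂_le b hb).trans hab

theorem mem_acut_iff_of_pos {Z : Type*} [MetricSpace Z] {u : Z → ℝ} {α : ℝ} (hα : 0 < α)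
    {x : Z} : x ∈ acut u α ↔ α ≤ u x := by
  simp [acut, hα.ne']

/-- If the endographs of `u` and `v` are closer than `δ`, points of the cut of `u` at level `α`
are close to points of the cut of `v` at any level at most `α - δ`. -/
theorem exists_mem_acut_of_HPstar_lt {Z : Type*} [MetricSpace Z] {u v : Z → ℝ} {α β δ : ℝ}
    {ε : ℝ≥0∞} (hβ : 0 < β) (hβα : β + δ ≤ α) (hα0 : 0 < α) (hα1 : α ≤ 1)
    (h : HPstar (endograph u) (endograph v) < min ε (ENNReal.ofReal δ)) {x : Z}
    (hx : x ∈ acut u α) : ∃ y ∈ acut v β, edist x y < ε := by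
  have hxu : (x, α) ∈ endograph u := ⟨⟨hα0.le, hα1⟩, (mem_acut_iff_of_pos hα0).1 hx⟩
  obtain ⟨⟨y, t⟩, hy, hlt⟩ := exists_lt_of_hStar_lt h hxu
  obtain ⟨hε, hδ⟩ := lt_min_iff.1 hlt
  refine ⟨y, (mem_acut_iff_of_pos hβ).2 ?_, lt_of_le_of_lt le_self_add hε⟩
  have ht : edist α t < ENNReal.ofReal δ := lt_of_le_of_lt le_add_self hδ
  rw [edist_lt_ofReal, Real.dist_eq] at ht
  have h1 := (abs_lt.1 ht).2
  have h2 : t ≤ v y := hy.2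
  linarith

/-- `H_end` convergence implies Hausdorff convergence of the α-cuts for each
`α ∈ (0,1) \ P₀(u)`. -/
theorem stmt10 (u : X → ℝ) (un : ℕ → X → ℝ) (hu : FUSC u) (hun : ∀ n, FUSC (un n))
    (h : Tendsto (fun n => Hend (un n) u) atTop (𝓝 0)) :
    ∀ α ∈ Ioo (0:ℝ) 1 \ P0set u,
      Tendsto (fun n => HXdist (acut (un n) α) (acut u α)) atTop (𝓝 0) := by
  rintro α ⟨hα, hP⟩
  have hlim : Tendsto (fun β => HXdist (acut u β) (acut u α)) (𝓝[Icc (0:ℝ) 1] α) (𝓝 0) := by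
    by_contra hc
    exact hP ⟨hα, hc⟩
  rw [nhdsWithin_eq_nhds.2 (Icc_mem_nhds hα.1 hα.2)] at hlim
  rw [ENNReal.tendsto_nhds_zero]
  intro ε hε
  have hε2 : 0 < ε / 2 := ENNReal.half_pos hε.ne'
  have hnear := (hlim.eventually_lt_const hε2).and (Ioo_mem_nhds hα.1 hα.2)
  obtain ⟨r, hr, hball⟩ := Metric.eventually_nhds_iff.1 hnear
  obtain ⟨δ, hδ, hδr⟩ := exists_between hr
  obtain ⟨hlow, hlow01⟩ := hball (y := α - δ) (by simpa [Real.dist_eq, abs_of_pos hδ] using hδr)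
  obtain ⟨hup, hup01⟩ := hball (y := α + δ) (by simpa [Real.dist_eq, abs_of_pos hδ] using hδr)
  have hγ : 0 < min (ε / 2) (ENNReal.ofReal δ) := lt_min hε2 (ENNReal.ofReal_pos.2 hδ)
  filter_upwards [h.eventually_lt_const hγ] with n hn
  obtain ⟨hn1, hn2⟩ := max_lt_iff.1 hn
  refine max_le (hStar_le_of_forall_exists fun x hx => ?_)
    (hStar_le_of_forall_exists fun x hx => ?_)
  · obtain ⟨y, hy, hxy⟩ := exists_mem_acut_of_HPstar_lt hlow01.1 (by linarith) hα.1 hα.2.le hn1 hx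
    obtain ⟨z, hz, hyz⟩ := exists_lt_of_hStar_lt (max_lt_iff.1 hlow).1 hy
    exact ⟨z, hz, (edist_triangle x y z).trans
      ((add_le_add hxy.le hyz.le).trans (ENNReal.add_halves ε).le)⟩
  · obtain ⟨y, hy, hxy⟩ := exists_lt_of_hStar_lt (max_lt_iff.1 hup).2 hx
    obtain ⟨z, hz, hyz⟩ := exists_mem_acut_of_HPstar_lt hα.1 le_rfl hup01.1 hup01.2.le hn2 hy
    exact ⟨z, hz, (edist_triangle x y z).trans
      ((add_le_add hxy.le hyz.le).trans (ENNReal.add_halves ε).le)⟩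

end
end

section
/- Let (X,d) be a metric space, let p ≥ 1, and let u, u_1, u_2, … be fuzzy sets in F¹_USC(X). If d_p*(u_n, u) → 0, then H_end(u_n, u) → 0. -/
open Set Filter Topology MeasureTheory
open scoped ENNReal NNReal

noncomputable section

variable {X : Type*} [MetricSpace X]

/-- If the integral of `f ^ p` over `[0,1]` is less than `ε ^ p * ε`, then every interval
`(t - ε, t]` inside `[0,1]` contains a point at which `f` is less than `ε`. -/
lemma exists_mem_Ioc_lt_of_lintegral_rpow_lt {p ε t : ℝ} (hp : 0 ≤ p)
    (hεt : ε ≤ t) (ht : t ≤ 1) {f : ℝ → ℝ≥0∞}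
    (hf : ∫⁻ α in Icc (0:ℝ) 1, f α ^ p < ENNReal.ofReal ε ^ p * ENNReal.ofReal ε) :
    ∃ α ∈ Ioc (t - ε) t, f α < ENNReal.ofReal ε := by
  by_contra! hge
  refine hf.not_ge ?_
  calc ENNReal.ofReal ε ^ p * ENNReal.ofReal ε
      = ∫⁻ _ in Ioc (t - ε) t, ENNReal.ofReal ε ^ p := by simp
    _ ≤ ∫⁻ α in Ioc (t - ε) t, f α ^ p :=
        setLIntegral_mono' measurableSet_Ioc fun α hα => ENNReal.rpow_le_rpow (hge α hα) hp
    _ ≤ ∫⁻ α in Icc (0:ℝ) 1, f α ^ p :=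
        lintegral_mono_set fun α hα => ⟨by linarith [hα.1], hα.2.trans ht⟩

lemma HPstar_endograph_le_s12 {p ε : ℝ} (hp : 0 ≤ p) {a b : X → ℝ}
    (hb : ∀ x, 0 ≤ b x) {f : ℝ → ℝ≥0∞}
    (hab : ∀ α ∈ Icc (0:ℝ) 1, HXstar (acut a α) (acut b α) ≤ f α)
    (hf : ∫⁻ α in Icc (0:ℝ) 1, f α ^ p < ENNReal.ofReal ε ^ p * ENNReal.ofReal ε) :
    HPstar (endograph a) (endograph b) ≤ ENNReal.ofReal ε + ENNReal.ofReal ε := by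
  refine iSup₂_le ?_
  rintro ⟨x, t⟩ ⟨⟨ht0, ht1⟩, htx⟩
  rcases lt_or_ge t ε with htε | hεt
  · refine (iInf₂_le (x, (0:ℝ)) ⟨by simp, hb x⟩).trans ?_
    have ht : edist t 0 ≤ ENNReal.ofReal ε := by
      rw [edist_dist, Real.dist_eq, sub_zero, abs_of_nonneg ht0]
      exact ENNReal.ofReal_le_ofReal htε.le
    simpa [dbar] using ht.trans le_self_add
  · obtain ⟨α, hα, hfα⟩ := exists_mem_Ioc_lt_of_lintegral_rpow_lt hp hεt ht1 hf
    have hα0 : 0 < α := by linarith [hα.1]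
    have hα1 : α ≤ 1 := hα.2.trans ht1
    have hx : x ∈ acut a α := by
      rw [acut, if_neg hα0.ne']
      exact hα.2.trans htx
    have hlt : ⨅ y ∈ acut b α, edist x y < ENNReal.ofReal ε :=
      ((le_iSup₂ (f := fun x _ => ⨅ y ∈ acut b α, edist x y) x hx).trans
        (hab α ⟨hα0.le, hα1⟩)).trans_lt hfα
    obtain ⟨y, hy, hxy⟩ := by simpa only [iInf_lt_iff, exists_prop] using hlt
    rw [acut, if_neg hα0.ne'] at hy
    refine (iInf₂_le (y, α) ⟨⟨hα0.le, hα1⟩, hy⟩).trans (add_le_add hxy.le ?_)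
    rw [edist_dist, Real.dist_eq, abs_of_nonneg (sub_nonneg.2 hα.2)]
    exact ENNReal.ofReal_le_ofReal (by linarith [hα.1])

lemma Hend_le_of_dpstar_lt {p ε : ℝ} (hp : 0 < p) {u v : X → ℝ}
    (hu : ∀ x, 0 ≤ u x) (hv : ∀ x, 0 ≤ v x)
    (h : dpstar p u v < (ENNReal.ofReal ε ^ p * ENNReal.ofReal ε) ^ (1 / p)) :
    Hend u v ≤ ENNReal.ofReal ε + ENNReal.ofReal ε := by
  obtain ⟨f, ⟨-, hle⟩, hf⟩ := by simpa only [dpstar, iInf_lt_iff, exists_prop] using h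
  rw [ENNReal.rpow_lt_rpow_iff (one_div_pos.2 hp)] at hf
  exact max_le
    (HPstar_endograph_le_s12 hp.le hv (fun α hα => (le_max_left _ _).trans (hle α hα)) hf)
    (HPstar_endograph_le_s12 hp.le hu (fun α hα => (le_max_right _ _).trans (hle α hα)) hf)

/-- `d_p^*` convergence implies `H_end` convergence. -/
theorem stmt12 (p : ℝ) (hp : 1 ≤ p) (u : X → ℝ) (un : ℕ → X → ℝ)
    (hu : FUSC u) (hun : ∀ n, FUSC (un n))
    (h : Tendsto (fun n => dpstar p (un n) u) atTop (𝓝 0)) :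
    Tendsto (fun n => Hend (un n) u) atTop (𝓝 0) := by
  have hp0 : 0 < p := zero_lt_one.trans_le hp
  rw [ENNReal.tendsto_nhds_zero]
  intro η hη
  obtain ⟨δ, hδ0, hδη⟩ := ENNReal.lt_iff_exists_nnreal_btwn.1 hη
  have hδ : (0:ℝ) < δ := by exact_mod_cast hδ0
  have hpos : 0 < ENNReal.ofReal (δ / 2) := ENNReal.ofReal_pos.2 (half_pos hδ)
  have hbound : 0 < (ENNReal.ofReal (δ / 2) ^ p * ENNReal.ofReal (δ / 2)) ^ (1 / p) :=
    ENNReal.rpow_pos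
      (ENNReal.mul_pos (ENNReal.rpow_pos hpos ENNReal.ofReal_ne_top).ne' hpos.ne')
      (ENNReal.mul_ne_top (ENNReal.rpow_ne_top_of_nonneg hp0.le ENNReal.ofReal_ne_top)
        ENNReal.ofReal_ne_top)
  filter_upwards [h.eventually_lt_const hbound] with n hn
  calc Hend (un n) u ≤ ENNReal.ofReal (δ / 2) + ENNReal.ofReal (δ / 2) :=
        Hend_le_of_dpstar_lt hp0 (fun x => ((hun n).1 x).1)
          (fun x => (hu.1 x).1) hn
    _ = δ := by
        rw [← ENNReal.ofReal_add (half_pos hδ).le (half_pos hδ).le, add_halves,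
          ENNReal.ofReal_coe_nnreal]
    _ ≤ η := hδη.le

end
end

section
/- Let (X,d) be a metric space and let 𝒟 ⊆ K(X). Then 𝒟 is relatively compact in (K(X), H) (i.e., its closure in (K(X), H) is compact) if and only if the union ∪{C : C ∈ 𝒟} is relatively compact in (X,d). -/
open Set Filter Topology MeasureTheory
open scoped ENNReal NNReal

noncomputable section

variable {X : Type*} [MetricSpace X]

open TopologicalSpace in
/-- `𝒟 ⊆ K(X)` is relatively compact in `(K(X), H)` iff `⋃ 𝒟` is
relatively compact in `X`. -/
theorem stmt15 (𝒟 : Set (NonemptyCompacts X)) :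
    IsCompact (closure 𝒟) ↔ IsCompact (closure (⋃ C ∈ 𝒟, (C : Set X))) := by
  constructor
  · intro h
    exact (NonemptyCompacts.isCompact_biUnion_coe_of_isCompact h).closure_of_subset
      (biUnion_subset_biUnion_left subset_closure)
  · intro h
    exact (NonemptyCompacts.isCompact_subsets_of_isCompact h).closure_of_subset
      fun C hC => (subset_biUnion_of_mem (u := fun C : NonemptyCompacts X => (C : Set X)) hC).trans
        subset_closure

end
end
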